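/- For any f ∈ AP(ℝ): (1) for every λ ∈ ℝ the mean ℰf(λ) = lim_{T→∞} (1/2T) ∫_{−T}^{T} f(x) e^{−2πiλx} dx exists; (2) the spectrum spec(f) = {λ ∈ ℝ : ℰf(λ) ≠ 0} is at most countable; (3) if spec(f) = ∅ then f = 0 identically. -/

import Mathlib

open MeasureTheory Complex Filter Topology Set
open scoped ENNReal

noncomputable section

/-- The open upper half-plane, as a subset of `ℂ`. -/
def UHP : Set ℂ := {z : ℂ | 0 < z.im}

/-- A relatively dense subset of `ℝ`. -/
def RelDense (τ : Set ℝ) : Prop := ∃ l > (0:ℝ), ∀ x : ℝ, ∃ t ∈ τ, x < t ∧ t < x + l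

/-- Bohr almost periodic continuous functions on `ℝ`. -/
def APR (f : ℝ → ℂ) : Prop :=
  Continuous f ∧ ∀ ε > (0:ℝ), RelDense {t : ℝ | ∀ x : ℝ, ‖f x - f (x + t)‖ ≤ ε}

/-- Holomorphic almost periodic functions on the upper half-plane. -/
def APH (f : ℂ → ℂ) : Prop :=
  DifferentiableOn ℂ f UHP ∧
  ∀ α β ε : ℝ, 0 < α → α < β → 0 < ε →
    ∃ τ : Set ℝ, RelDense τ ∧
      ∀ t ∈ τ, ∀ z : ℂ, α < z.im → z.im < β → ‖f z - f (z + (t : ℂ))‖ ≤ ε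

/-- `HasMeanAt f y lam c` : the mean `(1/2T)∫_{-T+iy}^{T+iy} f(z) e^{-2πiλz} dz` tends to `c`. -/
def HasMeanAt (f : ℂ → ℂ) (y lam : ℝ) (c : ℂ) : Prop :=
  Tendsto (fun T : ℝ => (1 / (2 * (T : ℂ))) *
      ∫ x in (-T)..T, f ((x : ℂ) + (y : ℂ) * Complex.I) *
        Complex.exp (-(2 * (Real.pi : ℂ) * Complex.I * (lam : ℂ) * ((x : ℂ) + (y : ℂ) * Complex.I))))
    atTop (𝓝 c)

/-- `HasMeanR f lam c` : the Bohr mean `(1/2T)∫_{-T}^{T} f(x) e^{-2πiλx} dx` tends to `c`. -/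
def HasMeanR (f : ℝ → ℂ) (lam : ℝ) (c : ℂ) : Prop :=
  Tendsto (fun T : ℝ => (1 / (2 * (T : ℂ))) *
      ∫ x in (-T)..T, f x *
        Complex.exp (-(2 * (Real.pi : ℂ) * Complex.I * (lam : ℂ) * (x : ℂ))))
    atTop (𝓝 c)

/-- The spectrum of a function on the upper half-plane: frequencies where the mean is not `0`. -/
def specH (f : ℂ → ℂ) : Set ℝ := {lam : ℝ | ∃ y > (0:ℝ), ¬ HasMeanAt f y lam 0}

/-- A locally finite subset of `ℝ`. -/
def LocFinSet (S : Set ℝ) : Prop := ∀ a b : ℝ, (S ∩ Set.Ioo a b).Finite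

/-- A uniformly discrete subset of `ℝ`. -/
def UnifDiscrete (S : Set ℝ) : Prop :=
  ∃ d > (0:ℝ), ∀ x ∈ S, ∀ y ∈ S, x ≠ y → d ≤ |x - y|

/-- Locally summable coefficient functions. -/
def LocSummable (a : ℝ → ℂ) : Prop :=
  (Function.support a).Countable ∧
  ∀ T > (0:ℝ), Summable (Set.indicator (Set.Icc (-T) T) fun l => ‖a l‖)

/-- Exponential growth of a coefficient function. -/
def ExpGrowth (a : ℝ → ℂ) : Prop :=
  ∃ c > (0:ℝ), Summable fun lam : ℝ => ‖a lam‖ * Real.exp (-c * |lam|)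

/-- `a(-λ) = conj (a(λ))`. -/
def Antipodal (a : ℝ → ℂ) : Prop := ∀ lam : ℝ, a (-lam) = (starRingEnd ℂ) (a lam)

/-- The Fourier transform `φ̂(ξ) = ∫ φ(x) e^{-2πixξ} dx`. -/
def FT (φ : ℝ → ℂ) (ξ : ℝ) : ℂ :=
  ∫ x : ℝ, φ x * Complex.exp (-(2 * (Real.pi : ℂ) * Complex.I * (x : ℂ) * (ξ : ℂ)))

/-- A complex-valued measure on `ℝ`, encoded by its total variation `ν` together with a
unimodular density `w`, so that `dμ = w dν` and `|μ| = ν`. -/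
structure CMeasure where
  ν : Measure ℝ
  w : ℝ → ℂ
  meas : Measurable w
  unit : ∀ᵐ t ∂ν, ‖w t‖ = 1

/-- Integration against a complex measure. -/
def CMeasure.integral (μ : CMeasure) (φ : ℝ → ℂ) : ℂ := ∫ t, φ t * μ.w t ∂μ.ν

/-- Strongly tempered: every Schwartz function is `|μ|`-integrable. -/
def CMeasure.IsStronglyTempered (μ : CMeasure) : Prop :=
  ∀ φ : SchwartzMap ℝ ℂ, Integrable (fun t => φ t) μ.ν

/-- Real-valued complex measure. -/
def CMeasure.RealValued (μ : CMeasure) : Prop := ∀ᵐ t ∂μ.ν, (μ.w t).im = 0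

/-- Nonnegative complex measure. -/
def CMeasure.Nonneg (μ : CMeasure) : Prop := ∀ᵐ t ∂μ.ν, μ.w t = 1

/-- `deg(μ) ≤ n` : `∫ (1+t²)^{-n/2} d|μ| < ∞`. -/
def CMeasure.DegLE (μ : CMeasure) (n : ℕ) : Prop :=
  Integrable (fun t : ℝ => (1 + t ^ 2) ^ (-(n : ℝ) / 2)) μ.ν

/-- The mass `μ({x})` of an atom. -/
def CMeasure.atom (μ : CMeasure) (x : ℝ) : ℂ := ∫ t in {x}, μ.w t ∂μ.ν

/-- The (closed) support of a measure on `ℝ`. -/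
def measSupport (ν : Measure ℝ) : Set ℝ := {x : ℝ | ∀ U ∈ 𝓝 x, ν U ≠ 0}

/-- `(μ, a)` is a Fourier summation pair. -/
def IsFSPair (μ : CMeasure) (a : ℝ → ℂ) : Prop :=
  μ.IsStronglyTempered ∧ LocSummable a ∧
    ∀ φ : ℝ → ℂ, ContDiff ℝ (⊤ : ℕ∞) φ → HasCompactSupport φ →
      μ.integral (FT φ) = ∑' lam : ℝ, a lam * φ lam

/-- Trigonometric polynomials. -/
def IsTrigPoly (f : ℂ → ℂ) : Prop :=
  ∃ (N : ℕ) (p : Fin N → ℂ) (θ : Fin N → ℝ),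
    ∀ z : ℂ, f z = ∑ n, p n * Complex.exp (2 * (Real.pi : ℂ) * Complex.I * (θ n : ℂ) * z)

/-- Functions of bounded type on the upper half-plane. -/
def BoundedType (g : ℂ → ℂ) : Prop :=
  ∃ P Q : ℂ → ℂ, DifferentiableOn ℂ P UHP ∧ DifferentiableOn ℂ Q UHP ∧
    (∃ C : ℝ, ∀ z ∈ UHP, ‖P z‖ ≤ C) ∧ (∃ C : ℝ, ∀ z ∈ UHP, ‖Q z‖ ≤ C) ∧
    (∀ z ∈ UHP, Q z ≠ 0) ∧ ∀ z ∈ UHP, g z = P z / Q z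

/-- Mean type `ϑ(g) = limsup_{y→∞} log|g(iy)|/y`. -/
def MeanType (g : ℂ → ℂ) : ℝ :=
  Filter.limsup (fun y : ℝ => Real.log ‖g ((y : ℂ) * Complex.I)‖ / y) atTop

/-- `E*(z) = conj (E (conj z))`. -/
def fstar (E : ℂ → ℂ) : ℂ → ℂ := fun z => (starRingEnd ℂ) (E ((starRingEnd ℂ) z))

/-- Hermite–Biehler class: entire with `|E*(z)| < |E(z)|` on the upper half-plane. -/
def HB (E : ℂ → ℂ) : Prop := Differentiable ℂ E ∧ ∀ z ∈ UHP, ‖fstar E z‖ < ‖E z‖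

/-- `A = (E* + E)/2`. -/
def HBA (E : ℂ → ℂ) : ℂ → ℂ := fun z => (fstar E z + E z) / 2

/-- `B = (E* - E)/(2i)`. -/
def HBB (E : ℂ → ℂ) : ℂ → ℂ := fun z => (fstar E z - E z) / (2 * Complex.I)

/-- `φ` is a phase function for `E`, with derivative `φd > 0`. -/
def IsPhaseFor (φ φd : ℝ → ℝ) (E : ℂ → ℂ) : Prop :=
  (∀ x : ℝ, HasDerivAt φ (φd x) x) ∧ (∀ x : ℝ, 0 < φd x) ∧
    ∀ x : ℝ, (Complex.exp (Complex.I * (φ x : ℂ)) * E (x : ℂ)).im = 0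

/-- The points where `φ ≡ 0 (mod π)`. -/
def phaseZeros (φ : ℝ → ℝ) : Set ℝ := {γ : ℝ | ∃ k : ℤ, φ γ = k * Real.pi}

/-- The nonnegative measure `2π Σ_{φ(γ)≡0 (mod π)} (1/φ'(γ)) δ_γ`. -/
def phaseMeasure (φ φd : ℝ → ℝ) : Measure ℝ :=
  Measure.sum fun γ : phaseZeros φ =>
    (ENNReal.ofReal (2 * Real.pi / φd (γ : ℝ))) • Measure.dirac (γ : ℝ)

/-- `μ` is an `ℕ`-valued nonnegative measure. -/
def CMeasure.NValued (μ : CMeasure) : Prop :=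
  μ.Nonneg ∧ ∃ (Λ : Set ℝ) (m : ℝ → ℕ), LocFinSet Λ ∧ (∀ γ ∈ Λ, 0 < m γ) ∧
    μ.ν = Measure.sum fun γ : Λ => (m (γ : ℝ) : ℝ≥0∞) • Measure.dirac (γ : ℝ)

/-- Bounded on every horizontal substrip of the upper half-plane. -/
def BddOnStrips (f : ℂ → ℂ) : Prop :=
  ∀ ε > (0:ℝ), ∃ C : ℝ, ∀ z : ℂ, ε < z.im → z.im < 1/ε → ‖f z‖ ≤ C

/-- The Fejér-type partial sums in formula (eq:fdef). -/
def fdefSum (a : ℝ → ℂ) (T : ℝ) (z : ℂ) : ℂ :=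
  a 0 / 2 + ∑' lam : ℝ,
    Set.indicator (Set.Ioo (0 : ℝ) T)
      (fun l => a l * (1 - (l : ℂ) / (T : ℂ)) *
        Complex.exp (2 * (Real.pi : ℂ) * Complex.I * (l : ℂ) * z)) lam

/-- An almost periodic function is bounded. -/
lemma APR.exists_bound {f : ℝ → ℂ} (hf : APR f) : ∃ C > 0, ∀ x, ‖f x‖ ≤ C := by
  obtain ⟨hc, hp⟩ := hf
  obtain ⟨l, hl, h⟩ := hp 1 one_pos
  obtain ⟨C, hC⟩ := (isCompact_Icc (a := 0) (b := l)).exists_bound_of_continuousOn hc.continuousOn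
  refine ⟨|C| + 1, by positivity, fun x => ?_⟩
  obtain ⟨t, ht, h1, h2⟩ := h (-x)
  have h3 := ht x
  have h4 := hC (x + t) ⟨by linarith, by linarith⟩
  have h5 := norm_le_norm_add_norm_sub' (f x) (f (x + t))
  linarith [le_abs_self C]

/-- An almost periodic function is uniformly continuous. -/
lemma APR.exists_delta {f : ℝ → ℂ} (hf : APR f) {ε : ℝ} (hε : 0 < ε) :
    ∃ δ > 0, ∀ x y, |x - y| ≤ δ → ‖f x - f y‖ ≤ ε := by
  obtain ⟨hc, hp⟩ := hf
  obtain ⟨l, hl, h⟩ := hp (ε / 3) (by positivity)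
  have huc := (isCompact_Icc (a := -1) (b := l + 1)).uniformContinuousOn_of_continuous
    hc.continuousOn
  obtain ⟨δ, hδ, hd⟩ := Metric.uniformContinuousOn_iff.1 huc (ε / 3) (by positivity)
  refine ⟨min (δ / 2) 1, by positivity, fun x y hxy => ?_⟩
  obtain ⟨t, ht, h1, h2⟩ := h (-x)
  have hxy' := abs_le.1 (hxy.trans (min_le_right _ _))
  have h3 := hd (x + t) ⟨by linarith, by linarith⟩ (y + t) ⟨by linarith, by linarith⟩ (by
    rw [Real.dist_eq, add_sub_add_right_eq_sub]
    linarith [min_le_left (δ / 2) 1])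
  rw [dist_eq_norm] at h3
  have h4 := ht x
  have h5 := ht y
  rw [norm_sub_rev] at h5
  calc ‖f x - f y‖ = ‖(f x - f (x + t)) + (f (x + t) - f (y + t)) + (f (y + t) - f y)‖ := by
        congr 1; ring
    _ ≤ _ := norm_add₃_le
    _ ≤ ε := by linarith

/-- The translates of an almost periodic function fall into finitely many uniformly small
classes. -/
lemma APR.exists_coloring {f : ℝ → ℂ} (hf : APR f) {ε : ℝ} (hε : 0 < ε) :
    ∃ (n : ℕ) (c : ℝ → Fin n), ∀ s t, c s = c t → ∀ x, ‖f (x + s) - f (x + t)‖ ≤ ε := by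
  obtain ⟨δ, hδ, hd⟩ := hf.exists_delta (ε := ε / 3) (by positivity)
  obtain ⟨l, hl, h⟩ := hf.2 (ε / 3) (by positivity)
  choose τ hτ h1 h2 using fun s : ℝ => h (s - l)
  have hlt (s : ℝ) : ⌊(s - τ s) / δ⌋₊ < ⌊l / δ⌋₊ + 1 := by
    refine Nat.lt_succ_of_le (Nat.floor_mono ?_)
    gcongr
    linarith [h1 s]
  refine ⟨⌊l / δ⌋₊ + 1, fun s => ⟨_, hlt s⟩, fun s t hst x => ?_⟩
  have hst' : ⌊(s - τ s) / δ⌋₊ = ⌊(t - τ t) / δ⌋₊ := by simpa using hst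
  have hs0 : 0 ≤ (s - τ s) / δ := div_nonneg (by linarith [h2 s]) hδ.le
  have ht0 : 0 ≤ (t - τ t) / δ := div_nonneg (by linarith [h2 t]) hδ.le
  have hclose : |(x + (s - τ s)) - (x + (t - τ t))| ≤ δ := by
    have e1 := Nat.floor_le hs0
    have e2 := Nat.lt_floor_add_one ((s - τ s) / δ)
    have e3 := Nat.floor_le ht0
    have e4 := Nat.lt_floor_add_one ((t - τ t) / δ)
    rw [hst'] at e1 e2
    have : |(s - τ s) / δ - (t - τ t) / δ| ≤ 1 := by
      rw [abs_le]; constructor <;> linarith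
    rw [← sub_div, abs_div, abs_of_pos hδ, div_le_one hδ] at this
    rwa [add_sub_add_left_eq_sub]
  have k1 := hτ s (x + (s - τ s))
  have k2 := hτ t (x + (t - τ t))
  have k3 := hd _ _ hclose
  rw [show x + (s - τ s) + τ s = x + s by ring, norm_sub_rev] at k1
  rw [show x + (t - τ t) + τ t = x + t by ring] at k2
  calc ‖f (x + s) - f (x + t)‖
      = ‖(f (x + s) - f (x + (s - τ s))) + (f (x + (s - τ s)) - f (x + (t - τ t)))
          + (f (x + (t - τ t)) - f (x + t))‖ := by congr 1; ring
    _ ≤ _ := norm_add₃_le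
    _ ≤ ε := by linarith

/-- A continuous function whose translates fall into finitely many uniformly small classes is
almost periodic. -/
lemma APR.of_coloring {f : ℝ → ℂ} (hc : Continuous f)
    (h : ∀ ε > 0, ∃ (n : ℕ) (c : ℝ → Fin n),
      ∀ s t, c s = c t → ∀ x, ‖f (x + s) - f (x + t)‖ ≤ ε) : APR f := by
  refine ⟨hc, fun ε hε => ?_⟩
  obtain ⟨n, c, h⟩ := h ε hε
  obtain ⟨R, hR⟩ := Finite.bddAbove_range fun i => |Function.invFun c i|
  have hR' (i) : |Function.invFun c i| ≤ R := hR ⟨i, rfl⟩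
  have hR0 : 0 ≤ R := (abs_nonneg _).trans (hR' (c 0))
  refine ⟨2 * R + 2, by positivity, fun x => ?_⟩
  have hb := abs_le.1 (hR' (c (x + R + 1)))
  refine ⟨x + R + 1 - Function.invFun c (c (x + R + 1)), fun y => ?_, by linarith, by linarith⟩
  have := h _ _ (Function.invFun_eq ⟨x + R + 1, rfl⟩ :
    c (Function.invFun c (c (x + R + 1))) = c (x + R + 1))
    (y - Function.invFun c (c (x + R + 1)))
  convert this using 4 <;> ring

lemma APR.mul {f g : ℝ → ℂ} (hf : APR f) (hg : APR g) : APR (fun x => f x * g x) := by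
  refine APR.of_coloring (hf.1.mul hg.1) fun ε hε => ?_
  obtain ⟨C, hC, hfC⟩ := hf.exists_bound
  obtain ⟨D, hD, hgD⟩ := hg.exists_bound
  obtain ⟨n, c, hc⟩ := hf.exists_coloring (ε := ε / (2 * D)) (by positivity)
  obtain ⟨m, d, hd⟩ := hg.exists_coloring (ε := ε / (2 * C)) (by positivity)
  refine ⟨n * m, fun s => finProdFinEquiv (c s, d s), fun s t hst x => ?_⟩
  obtain ⟨h1, h2⟩ := Prod.mk.inj (finProdFinEquiv.injective hst)
  calc ‖f (x + s) * g (x + s) - f (x + t) * g (x + t)‖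
      = ‖(f (x + s) - f (x + t)) * g (x + s) + f (x + t) * (g (x + s) - g (x + t))‖ := by
        congr 1; ring
    _ ≤ ‖f (x + s) - f (x + t)‖ * ‖g (x + s)‖ + ‖f (x + t)‖ * ‖g (x + s) - g (x + t)‖ := by
        rw [← norm_mul, ← norm_mul]; exact norm_add_le _ _
    _ ≤ ε / (2 * D) * D + C * (ε / (2 * C)) := by
        gcongr
        exacts [hc s t h1 x, hgD _, hfC _, hd s t h2 x]
    _ = ε := by field_simp; ring

lemma APR.conj {f : ℝ → ℂ} (hf : APR f) : APR (fun x => starRingEnd ℂ (f x)) := by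
  refine ⟨Complex.continuous_conj.comp hf.1, fun ε hε => ?_⟩
  simpa only [← map_sub, RCLike.norm_conj] using hf.2 ε hε

lemma APR.comp_add_right {f : ℝ → ℂ} (hf : APR f) (s : ℝ) : APR (fun x => f (x + s)) := by
  refine ⟨hf.1.comp (continuous_id.add continuous_const), fun ε hε => ?_⟩
  obtain ⟨l, hl, h⟩ := hf.2 ε hε
  refine ⟨l, hl, fun x => ?_⟩
  obtain ⟨t, ht, hxt⟩ := h x
  exact ⟨t, fun y => by simpa only [add_right_comm] using ht (y + s), hxt⟩

/-- The exponential `x ↦ e^{-2πiλx}`. -/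
def expNeg (lam x : ℝ) : ℂ := Complex.exp (-(2 * (Real.pi : ℂ) * Complex.I * (lam : ℂ) * (x : ℂ)))

@[fun_prop]
lemma continuous_expNeg (lam : ℝ) : Continuous (expNeg lam) := by unfold expNeg; fun_prop

lemma norm_expNeg (lam x : ℝ) : ‖expNeg lam x‖ = 1 := by
  rw [expNeg, show -(2 * (Real.pi : ℂ) * Complex.I * (lam : ℂ) * (x : ℂ))
    = ((-(2 * Real.pi * lam * x) : ℝ) : ℂ) * Complex.I by push_cast; ring]
  exact Complex.norm_exp_ofReal_mul_I _

lemma expNeg_add_right (lam x y : ℝ) : expNeg lam (x + y) = expNeg lam x * expNeg lam y := by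
  rw [expNeg, expNeg, expNeg, ← Complex.exp_add]; congr 1; push_cast; ring

lemma expNeg_add_left (lam mu x : ℝ) : expNeg (lam + mu) x = expNeg lam x * expNeg mu x := by
  rw [expNeg, expNeg, expNeg, ← Complex.exp_add]; congr 1; push_cast; ring

lemma expNeg_zero_left (x : ℝ) : expNeg 0 x = 1 := by simp [expNeg]

lemma conj_expNeg (lam x : ℝ) : starRingEnd ℂ (expNeg lam x) = expNeg (-lam) x := by
  rw [expNeg, expNeg, ← Complex.exp_conj]; congr 1; simp [Complex.conj_ofNat]

lemma APR_expNeg (lam : ℝ) : APR (expNeg lam) := by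
  refine ⟨continuous_expNeg lam, fun ε hε => ?_⟩
  rcases eq_or_ne lam 0 with rfl | hl
  · exact ⟨1, one_pos, fun x => ⟨x + 1 / 2, fun y => by simp [expNeg, hε.le], by linarith,
      by linarith⟩⟩
  have hp : 0 < |lam|⁻¹ := by positivity
  refine ⟨2 * |lam|⁻¹, by positivity, fun x => ?_⟩
  refine ⟨(⌊x / |lam|⁻¹⌋ + 1) * |lam|⁻¹, fun y => ?_, ?_, ?_⟩
  · have : expNeg lam ((⌊x / |lam|⁻¹⌋ + 1) * |lam|⁻¹) = 1 := by
      rw [expNeg, Complex.exp_eq_one_iff]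
      have hlam : (lam : ℂ) ≠ 0 := by exact_mod_cast hl
      rcases abs_choice lam with h | h <;> rw [h]
      · refine ⟨-(⌊x / lam⁻¹⌋ + 1), ?_⟩
        push_cast; field_simp
      · refine ⟨⌊x / (-lam)⁻¹⌋ + 1, ?_⟩
        push_cast; field_simp
    rw [expNeg_add_right, this, mul_one, sub_self, norm_zero]
    exact hε.le
  · have := Int.lt_floor_add_one (x / |lam|⁻¹)
    rwa [div_lt_iff₀ hp] at this
  · have := Int.floor_le (x / |lam|⁻¹)
    rw [le_div_iff₀ hp] at this
    linarith

/-- Bounds for integrals over intervals of length `L` give bounds for integrals over long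
intervals. -/
lemma norm_integral_le_of_blocks {h : ℝ → ℂ} (hc : Continuous h) {C D L : ℝ}
    (hC : ∀ x, ‖h x‖ ≤ C) (hL : 0 < L) (hD : ∀ a, ‖∫ x in a..(a + L), h x‖ ≤ D)
    (a : ℝ) {S : ℝ} (hS : 0 ≤ S) : ‖∫ x in a..(a + S), h x‖ ≤ S / L * D + C * L := by
  have hi (a b : ℝ) : IntervalIntegrable h volume a b := hc.intervalIntegrable a b
  have key (n : ℕ) : ‖∫ x in a..(a + n * L), h x‖ ≤ n * D := by
    induction n with
    | zero => simp
    | succ n ih =>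
      rw [← intervalIntegral.integral_add_adjacent_intervals (hi a (a + n * L)) (hi _ _)]
      refine (norm_add_le _ _).trans ?_
      have := hD (a + n * L)
      rw [show a + n * L + L = a + ((n + 1 : ℕ) : ℝ) * L by push_cast; ring] at this
      push_cast at *
      linarith
  have hD0 : 0 ≤ D := (norm_nonneg _).trans (hD 0)
  have hC0 : 0 ≤ C := (norm_nonneg _).trans (hC 0)
  have h1 : (⌊S / L⌋₊ : ℝ) ≤ S / L := Nat.floor_le (by positivity)
  have h2 := Nat.lt_floor_add_one (S / L)
  have h3 : (⌊S / L⌋₊ : ℝ) * L ≤ S := (le_div_iff₀ hL).1 h1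
  rw [div_lt_iff₀ hL] at h2
  rw [← intervalIntegral.integral_add_adjacent_intervals (hi a (a + ⌊S / L⌋₊ * L)) (hi _ _)]
  refine (norm_add_le _ _).trans (add_le_add ((key _).trans (by gcongr)) ?_)
  refine (intervalIntegral.norm_integral_le_of_norm_le_const fun x _ => hC x).trans ?_
  gcongr
  rw [abs_le]
  constructor <;> linarith

lemma norm_integral_sub_integral_le {h : ℝ → ℂ} (hc : Continuous h) {C : ℝ}
    (hC : ∀ x, ‖h x‖ ≤ C) (a b L : ℝ) :
    ‖(∫ x in a..(a + L), h x) - ∫ x in b..(b + L), h x‖ ≤ 2 * (C * |b - a|) := by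
  have hi (a b : ℝ) : IntervalIntegrable h volume a b := hc.intervalIntegrable a b
  have h1 := intervalIntegral.integral_interval_sub_interval_comm' (hi a (a + L)) (hi b (b + L))
    (hi a b)
  rw [h1]
  have h2 : ‖∫ x in (b + L)..(a + L), h x‖ ≤ C * |b - a| := by
    refine (intervalIntegral.norm_integral_le_of_norm_le_const fun x _ => hC x).trans_eq ?_
    rw [add_sub_add_right_eq_sub, abs_sub_comm]
  have h3 : ‖∫ x in b..a, h x‖ ≤ C * |b - a| := by
    rw [abs_sub_comm]
    exact intervalIntegral.norm_integral_le_of_norm_le_const fun x _ => hC x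
  refine (norm_sub_le _ _).trans (by linarith)

/-- Integrals of `f e^{-2πiλx}` over intervals of equal length have nearly equal modulus,
uniformly in `λ`. -/
lemma APR.norm_integral_expNeg_le {f : ℝ → ℂ} (hf : APR f) {ε : ℝ} (hε : 0 < ε) :
    ∃ K, ∀ lam a L : ℝ, 0 ≤ L → ‖∫ x in a..(a + L), f x * expNeg lam x‖ ≤
      ‖∫ x in 0..L, f x * expNeg lam x‖ + ε * L + K := by
  obtain ⟨C, hC, hfC⟩ := hf.exists_bound
  obtain ⟨l, hl, hper⟩ := hf.2 ε hε
  have hfc := hf.1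
  refine ⟨2 * (C * l), fun lam a L hL => ?_⟩
  obtain ⟨t, ht, hat, htl⟩ := hper a
  have hcont : Continuous fun x => f x * expNeg lam x := by fun_prop
  have h1 := norm_integral_sub_integral_le hcont
    (C := C) (fun x => by simpa [norm_expNeg] using hfC x) a t L
  rw [abs_of_pos (sub_pos.2 hat)] at h1
  have h2 : ∫ x in t..(t + L), f x * expNeg lam x
      = expNeg lam t * ∫ x in 0..L, f (x + t) * expNeg lam x := by
    rw [← intervalIntegral.integral_const_mul]
    have := intervalIntegral.integral_comp_add_right (a := 0) (b := L)
      (fun x => f x * expNeg lam x) t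
    rw [zero_add, add_comm L t] at this
    rw [← this]
    refine intervalIntegral.integral_congr fun x _ => ?_
    simp only [expNeg_add_right]
    ring
  have h3 : ‖(∫ x in 0..L, f (x + t) * expNeg lam x) - ∫ x in 0..L, f x * expNeg lam x‖
      ≤ ε * L := by
    rw [← intervalIntegral.integral_sub (Continuous.intervalIntegrable (by fun_prop) _ _)
      (Continuous.intervalIntegrable (by fun_prop) _ _)]
    refine (intervalIntegral.norm_integral_le_of_norm_le_const (C := ε) fun x _ => ?_).trans_eq ?_
    · rw [← sub_mul, norm_mul, norm_expNeg, mul_one, norm_sub_rev]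
      exact ht x
    · rw [sub_zero, abs_of_nonneg hL]
  have h4 : ‖∫ x in t..(t + L), f x * expNeg lam x‖
      = ‖∫ x in 0..L, f (x + t) * expNeg lam x‖ := by
    rw [h2, norm_mul, norm_expNeg, one_mul]
  have h5 := norm_le_norm_add_norm_sub' (∫ x in a..(a + L), f x * expNeg lam x)
    (∫ x in t..(t + L), f x * expNeg lam x)
  have h6 := norm_le_norm_add_norm_sub' (∫ x in 0..L, f (x + t) * expNeg lam x)
    (∫ x in 0..L, f x * expNeg lam x)
  have h7 : C * (t - a) ≤ C * l := by gcongr; linarith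
  linarith

/-- The mean of an almost periodic function is approached uniformly over all long intervals. -/
lemma APR.exists_approx_mean {h : ℝ → ℂ} (hh : APR h) {η : ℝ} (hη : 0 < η) :
    ∃ z : ℂ, ∃ S₀ > 0, ∀ S ≥ S₀, ∀ a, ‖(∫ x in a..(a + S), h x) - S * z‖ ≤ η * S := by
  obtain ⟨C, hC, hhC⟩ := hh.exists_bound
  obtain ⟨l, hl, hper⟩ := hh.2 (η / 3) (by positivity)
  have hhc := hh.1
  set L : ℝ := 6 * (C * l) / η with hLdef
  have hL : 0 < L := by positivity
  have hLe : 2 * (C * l) = η / 3 * L := by rw [hLdef]; field_simp; ring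
  set z : ℂ := (∫ x in 0..L, h x) / L with hz
  have hzL : (L : ℂ) * z = ∫ x in 0..L, h x := by
    have : (L : ℂ) ≠ 0 := by exact_mod_cast hL.ne'
    rw [hz]; field_simp
  have hzC : ‖z‖ ≤ C := by
    rw [hz, norm_div, Complex.norm_real, Real.norm_of_nonneg hL.le, div_le_iff₀ hL]
    refine (intervalIntegral.norm_integral_le_of_norm_le_const fun x _ => hhC x).trans_eq ?_
    rw [sub_zero, abs_of_pos hL]
  have hsub (a S : ℝ) : ∫ x in a..(a + S), (h x - z) = (∫ x in a..(a + S), h x) - S * z := by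
    rw [intervalIntegral.integral_sub (hhc.intervalIntegrable _ _)
      (continuous_const.intervalIntegrable _ _)]
    simp
  have hblock (a : ℝ) : ‖∫ x in a..(a + L), (h x - z)‖ ≤ 2 * (η / 3) * L := by
    obtain ⟨t, ht, hat, htl⟩ := hper a
    rw [hsub, hzL]
    have h1 := norm_integral_sub_integral_le hhc hhC a t L
    rw [abs_of_pos (sub_pos.2 hat)] at h1
    have h2 : ∫ x in t..(t + L), h x = ∫ x in 0..L, h (x + t) := by
      rw [intervalIntegral.integral_comp_add_right, zero_add, add_comm L t]
    have h3 : ‖(∫ x in 0..L, h (x + t)) - ∫ x in 0..L, h x‖ ≤ η / 3 * L := by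
      rw [← intervalIntegral.integral_sub (Continuous.intervalIntegrable (by fun_prop) _ _)
        (hhc.intervalIntegrable _ _)]
      refine (intervalIntegral.norm_integral_le_of_norm_le_const (C := η / 3)
        fun x _ => ?_).trans_eq ?_
      · rw [norm_sub_rev]
        exact ht x
      · rw [sub_zero, abs_of_pos hL]
    have h4 : C * (t - a) ≤ C * l := by gcongr; linarith
    rw [← h2] at h3
    have h5 := norm_sub_le_norm_sub_add_norm_sub (∫ x in a..(a + L), h x)
      (∫ x in t..(t + L), h x) (∫ x in 0..L, h x)
    linarith
  refine ⟨z, 6 * (C * L) / η, by positivity, fun S hS a => ?_⟩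
  have hS0 : 0 < S := lt_of_lt_of_le (by positivity) hS
  have hfin := norm_integral_le_of_blocks (h := fun x => h x - z) (by fun_prop) (C := 2 * C)
    (fun x => (norm_sub_le _ _).trans (by linarith [hhC x])) hL hblock a hS0.le
  rw [hsub] at hfin
  refine hfin.trans ?_
  rw [ge_iff_le, div_le_iff₀ hη] at hS
  have : S / L * (2 * (η / 3) * L) = 2 * (η / 3) * S := by field_simp
  rw [this]
  linarith

/-- `m` is the uniform mean value of `h`. -/
def UnifMean (h : ℝ → ℂ) (m : ℂ) : Prop :=
  ∀ η > (0 : ℝ), ∃ S₀ > 0, ∀ S ≥ S₀, ∀ a : ℝ, ‖(∫ x in a..(a + S), h x) - S * m‖ ≤ η * S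

/-- `m` is the mean value of `h` over `[0, S]` as `S → ∞`. -/
def HasMean (h : ℝ → ℂ) (m : ℂ) : Prop :=
  Tendsto (fun S : ℝ => (∫ x in 0..S, h x) / S) atTop (𝓝 m)

lemma norm_div_sub_le_of_norm_sub_mul_le {w z : ℂ} {S η : ℝ} (hS : 0 < S)
    (h : ‖w - S * z‖ ≤ η * S) : ‖w / S - z‖ ≤ η := by
  have : w / S - z = (w - S * z) / S := by
    have : (S : ℂ) ≠ 0 := by exact_mod_cast hS.ne'
    field_simp
  rwa [this, norm_div, Complex.norm_real, Real.norm_of_nonneg hS.le, div_le_iff₀ hS]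

lemma APR.exists_unifMean {h : ℝ → ℂ} (hh : APR h) : ∃ m, UnifMean h m := by
  set u : ℝ → ℂ := fun S => (∫ x in 0..S, h x) / S with hu
  have key {η : ℝ} (hη : 0 < η) : ∃ z : ℂ, ∃ S₀ > 0, (∀ S ≥ S₀, ‖u S - z‖ ≤ η) ∧
      ∀ S ≥ S₀, ∀ a, ‖(∫ x in a..(a + S), h x) - S * z‖ ≤ η * S := by
    obtain ⟨z, S₀, hS₀, hz⟩ := hh.exists_approx_mean hη
    refine ⟨z, S₀, hS₀, fun S hS => norm_div_sub_le_of_norm_sub_mul_le (hS₀.trans_le hS) ?_, hz⟩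
    simpa using hz S hS 0
  have hcau : CauchySeq u := by
    refine Metric.cauchySeq_iff'.2 fun ε hε => ?_
    obtain ⟨z, S₀, hS₀, hz, -⟩ := key (η := ε / 3) (by positivity)
    refine ⟨S₀, fun S hS => ?_⟩
    have h1 := hz S hS
    have h2 := hz S₀ le_rfl
    rw [norm_sub_rev] at h2
    rw [dist_eq_norm]
    linarith [norm_sub_le_norm_sub_add_norm_sub (u S) z (u S₀)]
  obtain ⟨m, hm⟩ := cauchySeq_tendsto_of_complete hcau
  refine ⟨m, fun η hη => ?_⟩
  obtain ⟨z, S₀, hS₀, hz, hz'⟩ := key (η := η / 2) (by positivity)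
  have hmz : ‖m - z‖ ≤ η / 2 :=
    le_of_tendsto (hm.sub_const z).norm (eventually_atTop.2 ⟨S₀, hz⟩)
  refine ⟨S₀, hS₀, fun S hS a => ?_⟩
  have hS0 : 0 < S := hS₀.trans_le hS
  have h1 := hz' S hS a
  have h2 : ‖(S : ℂ) * z - S * m‖ ≤ η / 2 * S := by
    rw [← mul_sub, norm_mul, Complex.norm_real, Real.norm_of_nonneg hS0.le, norm_sub_rev, mul_comm]
    gcongr
  linarith [norm_sub_le_norm_sub_add_norm_sub (∫ x in a..(a + S), h x) (S * z) (S * m)]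

lemma UnifMean.hasMean {h : ℝ → ℂ} {m : ℂ} (hm : UnifMean h m) : HasMean h m := by
  refine Metric.tendsto_atTop.2 fun ε hε => ?_
  obtain ⟨S₀, hS₀, hS⟩ := hm (ε / 2) (by positivity)
  refine ⟨S₀, fun S hSS => ?_⟩
  have := hS S hSS 0
  rw [zero_add] at this
  rw [dist_eq_norm]
  linarith [norm_div_sub_le_of_norm_sub_mul_le (hS₀.trans_le hSS) this]

lemma UnifMean.hasMeanR {f : ℝ → ℂ} {lam : ℝ} {m : ℂ}
    (hm : UnifMean (fun x => f x * expNeg lam x) m) : HasMeanR f lam m := by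
  refine Metric.tendsto_atTop.2 fun ε hε => ?_
  obtain ⟨S₀, hS₀, hS⟩ := hm (ε / 2) (by positivity)
  refine ⟨S₀, fun T hT => ?_⟩
  have hT0 : 0 < T := hS₀.trans_le hT
  have := hS (2 * T) (by linarith) (-T)
  rw [show -T + 2 * T = T by ring] at this
  have := norm_div_sub_le_of_norm_sub_mul_le (by positivity) this
  rw [dist_eq_norm, one_div, mul_comm, ← div_eq_mul_inv]
  push_cast at this
  simp only [expNeg] at this
  linarith

lemma HasMean.add {f g : ℝ → ℂ} {a b : ℂ} (hfc : Continuous f) (hgc : Continuous g)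
    (hf : HasMean f a) (hg : HasMean g b) : HasMean (fun x => f x + g x) (a + b) := by
  refine (Tendsto.add hf hg).congr fun S => ?_
  rw [intervalIntegral.integral_add (hfc.intervalIntegrable _ _) (hgc.intervalIntegrable _ _),
    add_div]

lemma HasMean.const_mul {f : ℝ → ℂ} {a : ℂ} (hf : HasMean f a) (c : ℂ) :
    HasMean (fun x => c * f x) (c * a) := by
  refine (Tendsto.const_mul c hf).congr fun S => ?_
  rw [intervalIntegral.integral_const_mul, mul_div_assoc]

lemma HasMean.sum {ι : Type*} (s : Finset ι) {f : ι → ℝ → ℂ} {a : ι → ℂ}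
    (hfc : ∀ i ∈ s, Continuous (f i)) (hf : ∀ i ∈ s, HasMean (f i) (a i)) :
    HasMean (fun x => ∑ i ∈ s, f i x) (∑ i ∈ s, a i) := by
  refine (tendsto_finsetSum s hf).congr fun S => ?_
  rw [intervalIntegral.integral_finsetSum fun i hi => (hfc i hi).intervalIntegrable _ _,
    Finset.sum_div]

lemma HasMean.one : HasMean (fun _ => 1) 1 := by
  refine tendsto_const_nhds.congr' ?_
  filter_upwards [eventually_gt_atTop 0] with S hS
  have : (S : ℂ) ≠ 0 := by exact_mod_cast hS.ne'
  simp [this]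

lemma HasMean.re_nonneg {f : ℝ → ℂ} {a : ℂ} (hfc : Continuous f) (hf : HasMean f a)
    (h : ∀ x, 0 ≤ (f x).re) : 0 ≤ a.re := by
  refine ge_of_tendsto' ((Complex.continuous_re.tendsto a).comp
    (hf.comp tendsto_natCast_atTop_atTop)) fun n => ?_
  have h1 : (∫ x in (0:ℝ)..n, f x).re = ∫ x in (0:ℝ)..n, (f x).re :=
    (Complex.reCLM.intervalIntegral_comp_comm (hfc.intervalIntegrable _ _)).symm
  simp only [Function.comp, Complex.div_ofReal_re]
  rw [h1]
  exact div_nonneg (intervalIntegral.integral_nonneg n.cast_nonneg fun x _ => h x) n.cast_nonneg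

lemma hasMean_expNeg {lam : ℝ} (h : lam ≠ 0) : HasMean (expNeg lam) 0 := by
  set c : ℂ := -(2 * (Real.pi : ℂ) * Complex.I * (lam : ℂ)) with hc
  have hc0 : c ≠ 0 := by simp [hc, h, Real.pi_ne_zero]
  refine squeeze_zero_norm' (a := fun S : ℝ => (2 / ‖c‖) / S) ?_
    (tendsto_const_nhds.div_atTop tendsto_id)
  filter_upwards [eventually_gt_atTop 0] with S hS
  have hint : ∫ x in 0..S, expNeg lam x = (expNeg lam S - 1) / c := by
    have := integral_exp_mul_complex (a := 0) (b := S) hc0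
    simpa [expNeg, hc, neg_mul] using this
  rw [norm_div, Complex.norm_real, Real.norm_of_nonneg hS.le, hint, norm_div]
  gcongr
  refine (norm_sub_le _ _).trans_eq ?_
  rw [norm_expNeg, norm_one]
  norm_num

/-- Bessel's inequality for the mean value. -/
lemma sum_norm_sq_le_of_hasMean {f : ℝ → ℂ} (hfc : Continuous f) {C : ℝ} (hC : ∀ x, ‖f x‖ ≤ C)
    {m : ℝ → ℂ} (hm : ∀ lam, HasMean (fun x => f x * expNeg lam x) (m lam)) (s : Finset ℝ) :
    ∑ lam ∈ s, ‖m lam‖ ^ 2 ≤ C ^ 2 := by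
  set q : ℝ → ℂ := fun x => ∑ lam ∈ s, starRingEnd ℂ (m lam) * expNeg lam x with hq
  have hqc : Continuous q := by fun_prop
  have hsum (lam : ℝ) : starRingEnd ℂ (m lam) * m lam = ((‖m lam‖ ^ 2 : ℝ) : ℂ) := by
    rw [mul_comm, Complex.mul_conj, Complex.normSq_eq_norm_sq]
  have hfq : HasMean (fun x => f x * q x) ((∑ lam ∈ s, ‖m lam‖ ^ 2 : ℝ) : ℂ) := by
    have := HasMean.sum s (fun lam _ => by fun_prop)
      fun lam _ => (hm lam).const_mul (starRingEnd ℂ (m lam))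
    simp only [hsum] at this
    push_cast at this ⊢
    convert! this using 2 with x
    rw [hq, Finset.mul_sum]
    exact Finset.sum_congr rfl fun lam _ => by ring
  have hqe (mu : ℝ) (hmu : mu ∈ s) :
      HasMean (fun x => q x * starRingEnd ℂ (expNeg mu x)) (starRingEnd ℂ (m mu)) := by
    have := HasMean.sum s
      (f := fun lam x => starRingEnd ℂ (m lam) * expNeg (lam + -mu) x)
      (a := fun lam => if lam = mu then starRingEnd ℂ (m mu) else 0) (fun lam _ => by fun_prop)
      fun lam _ => ?_
    · rw [Finset.sum_ite_eq' s mu, if_pos hmu] at this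
      convert! this using 2 with x
      rw [hq, Finset.sum_mul]
      refine Finset.sum_congr rfl fun lam _ => ?_
      rw [expNeg_add_left, conj_expNeg, mul_assoc]
    · split_ifs with h
      · subst h
        simpa [expNeg_zero_left] using HasMean.one.const_mul (starRingEnd ℂ (m lam))
      · simpa using (hasMean_expNeg (lam := lam + -mu)
          (by rwa [← sub_eq_add_neg, sub_ne_zero])).const_mul (starRingEnd ℂ (m lam))
  have hqq : HasMean (fun x => q x * starRingEnd ℂ (q x))
      ((∑ lam ∈ s, ‖m lam‖ ^ 2 : ℝ) : ℂ) := by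
    have := HasMean.sum s (fun lam _ => by
        have := continuous_expNeg lam
        have := Complex.continuous_conj
        fun_prop)
      fun lam hlam => (hqe lam hlam).const_mul (m lam)
    simp only [mul_comm (m _) (starRingEnd ℂ (m _)), hsum] at this
    push_cast at this ⊢
    convert! this using 2 with x
    rw [show starRingEnd ℂ (q x) = ∑ lam ∈ s, m lam * starRingEnd ℂ (expNeg lam x) by
      rw [hq]; simp, Finset.mul_sum]
    exact Finset.sum_congr rfl fun lam _ => by ring
  have hfin := HasMean.add (by fun_prop) (by fun_prop)
    (HasMean.add (by have := Complex.continuous_conj; fun_prop) (by fun_prop) hqq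
      (hfq.const_mul (-2))) (HasMean.one.const_mul ((C ^ 2 : ℝ) : ℂ))
  have := hfin.re_nonneg (by have := Complex.continuous_conj; fun_prop) fun x => ?_
  · rw [← Complex.ofReal_one, ← Complex.ofReal_ofNat, ← Complex.ofReal_neg, ← Complex.ofReal_mul,
      ← Complex.ofReal_mul, ← Complex.ofReal_add, ← Complex.ofReal_add, Complex.ofReal_re] at this
    linarith
  · rw [Complex.mul_conj, Complex.normSq_eq_norm_sq]
    have h1 : ((-2 : ℂ) * (f x * q x)).re = -2 * (f x * q x).re := by
      simp
    rw [Complex.add_re, Complex.add_re, h1, mul_one, Complex.ofReal_re, Complex.ofReal_re]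
    have h2 := Complex.re_le_norm (f x * q x)
    rw [norm_mul] at h2
    have h3 : ‖f x‖ * ‖q x‖ ≤ C * ‖q x‖ := by gcongr; exact hC x
    nlinarith [sq_nonneg (‖q x‖ - C)]

lemma countable_of_hasMean {f : ℝ → ℂ} (hfc : Continuous f) {C : ℝ} (hC : ∀ x, ‖f x‖ ≤ C)
    {m : ℝ → ℂ} (hm : ∀ lam, HasMean (fun x => f x * expNeg lam x) (m lam)) :
    {lam : ℝ | m lam ≠ 0}.Countable := by
  have := (summable_of_sum_le (fun lam => sq_nonneg ‖m lam‖)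
    (sum_norm_sq_le_of_hasMean hfc hC hm)).countable_support
  convert this using 1
  ext lam
  simp

/-- An almost periodic function whose square has mean zero vanishes. -/
lemma APR.eq_zero_of_hasMean {f : ℝ → ℂ} (hf : APR f)
    (h : HasMean (fun x => f x * starRingEnd ℂ (f x)) 0) (x₀ : ℝ) : f x₀ = 0 := by
  by_contra hne
  set κ : ℝ := ‖f x₀‖ / 3 with hκ
  have hκ0 : 0 < κ := by positivity
  have hfc := hf.1
  obtain ⟨δ, hδ, hd⟩ := hf.exists_delta hκ0
  obtain ⟨l, hl, hper⟩ := hf.2 κ hκ0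
  have hi (a b : ℝ) : IntervalIntegrable (fun x => ‖f x‖ ^ 2) volume a b :=
    Continuous.intervalIntegrable (by fun_prop) a b
  have hblock (a : ℝ) : κ ^ 2 * δ ≤ ∫ x in a..(a + (l + δ)), ‖f x‖ ^ 2 := by
    obtain ⟨t, ht, h1, h2⟩ := hper (a - x₀)
    have e1 : κ ^ 2 * δ = ∫ x in (x₀ + t)..(x₀ + t + δ), κ ^ 2 := by simp; ring
    rw [e1]
    refine (intervalIntegral.integral_mono_on (by linarith) (by simp) (hi _ _)
      fun x hx => ?_).trans (intervalIntegral.integral_mono_interval (by linarith) (by linarith)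
        (by linarith) (ae_of_all _ fun x => by positivity) (hi _ _))
    have h3 := ht x₀
    have h4 := hd (x₀ + t) x (by rw [abs_le]; constructor <;> linarith [hx.1, hx.2])
    have h5 := norm_le_norm_add_norm_sub' (f x₀) (f (x₀ + t))
    have h6 := norm_le_norm_add_norm_sub' (f (x₀ + t)) (f x)
    gcongr
    linarith
  have key (n : ℕ) : n * (κ ^ 2 * δ) ≤ ∫ x in 0..(n * (l + δ)), ‖f x‖ ^ 2 := by
    induction n with
    | zero => simp
    | succ n ih =>
      rw [← intervalIntegral.integral_add_adjacent_intervals (hi 0 (n * (l + δ))) (hi _ _)]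
      have := hblock (n * (l + δ))
      rw [show (n : ℝ) * (l + δ) + (l + δ) = ((n + 1 : ℕ) : ℝ) * (l + δ) by push_cast; ring] at this
      push_cast at *
      linarith
  have htend : Tendsto (fun n : ℕ => (n : ℝ) * (l + δ)) atTop atTop :=
    tendsto_natCast_atTop_atTop.atTop_mul_const (by positivity)
  have hlim := (h.comp htend).norm
  rw [norm_zero] at hlim
  have hge : κ ^ 2 * δ / (l + δ) ≤ 0 := by
    refine ge_of_tendsto hlim ?_
    filter_upwards [eventually_gt_atTop 0] with n hn
    have hn' : (0 : ℝ) < n := by exact_mod_cast hn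
    have e : ∫ x in 0..(n * (l + δ)), f x * starRingEnd ℂ (f x)
        = ((∫ x in 0..(n * (l + δ)), ‖f x‖ ^ 2 : ℝ) : ℂ) := by
      rw [← intervalIntegral.integral_ofReal]
      refine intervalIntegral.integral_congr fun x _ => ?_
      simp only [Complex.mul_conj, Complex.normSq_eq_norm_sq]
    rw [Function.comp, e, ← Complex.ofReal_div, Complex.norm_real]
    refine le_trans ?_ (le_abs_self _)
    rw [div_le_div_iff₀ (by positivity) (by positivity)]
    have := mul_le_mul_of_nonneg_right (key n) (by positivity : 0 ≤ l + δ)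
    linarith
  have : 0 < κ ^ 2 * δ / (l + δ) := by positivity
  linarith

lemma continuous_integral_expNeg {f : ℝ → ℂ} (hfc : Continuous f) (L : ℝ) :
    Continuous fun lam => ∫ x in 0..L, f x * expNeg lam x := by
  refine intervalIntegral.continuous_parametric_intervalIntegral_of_continuous' ?_ _ _
  unfold expNeg
  fun_prop

lemma tendsto_integral_expNeg_cocompact (f : ℝ → ℂ) {L : ℝ} (hL : 0 ≤ L) :
    Tendsto (fun lam => ∫ x in 0..L, f x * expNeg lam x) (cocompact ℝ) (𝓝 0) := by
  refine (Real.tendsto_integral_exp_smul_cocompact ((Set.Ioc 0 L).indicator f)).congr fun lam => ?_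
  rw [intervalIntegral.integral_of_le hL, ← integral_indicator measurableSet_Ioc]
  refine integral_congr_ae (ae_of_all _ fun x => ?_)
  by_cases hx : x ∈ Set.Ioc 0 L
  · simp only [Set.indicator_of_mem hx, Circle.smul_def, Real.fourierChar_apply, smul_eq_mul,
      expNeg, mul_comm (f x)]
    congr 2
    push_cast
    ring
  · simp [Set.indicator_of_notMem hx]

/-- If all Fourier coefficients of an almost periodic function vanish, then the averages against
exponentials tend to zero uniformly in the frequency and in the position of the interval. -/
lemma APR.uniform_small {f : ℝ → ℂ} (hf : APR f)
    (hm : ∀ lam, HasMean (fun x => f x * expNeg lam x) 0) {η : ℝ} (hη : 0 < η) :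
    ∃ S₀ > 0, ∀ S ≥ S₀, ∀ lam a, ‖∫ x in a..(a + S), f x * expNeg lam x‖ ≤ η * S := by
  obtain ⟨C, hC, hfC⟩ := hf.exists_bound
  obtain ⟨K, hK⟩ := hf.norm_integral_expNeg_le (ε := η / 4) (by positivity)
  have hfc := hf.1
  let P : Set ℝ → Prop := fun U => ∃ S₀ > 0, ∀ S ≥ S₀, ∀ lam ∈ U, ∀ a,
    ‖∫ x in a..(a + S), f x * expNeg lam x‖ ≤ η * S
  have hmono : ∀ ⦃s t : Set ℝ⦄, s ⊆ t → P t → P s := by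
    rintro s t hst ⟨S₀, hS₀, h⟩
    exact ⟨S₀, hS₀, fun S hS lam hlam a => h S hS lam (hst hlam) a⟩
  have hunion : ∀ ⦃s t : Set ℝ⦄, P s → P t → P (s ∪ t) := by
    rintro s t ⟨S₀, hS₀, h⟩ ⟨S₁, -, h'⟩
    refine ⟨max S₀ S₁, lt_max_of_lt_left hS₀, fun S hS lam hlam a => ?_⟩
    rcases hlam with hlam | hlam
    · exact h S ((le_max_left _ _).trans hS) lam hlam a
    · exact h' S ((le_max_right _ _).trans hS) lam hlam a
  have hprop {L : ℝ} (hL : 0 < L) (hKL : K ≤ η / 4 * L) :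
      P {lam | ‖∫ x in 0..L, f x * expNeg lam x‖ < η / 4 * L} := by
    refine ⟨4 * (C * L) / η, by positivity, fun S hS lam hlam a => ?_⟩
    have hS0 : 0 < S := lt_of_lt_of_le (by positivity) hS
    refine (norm_integral_le_of_blocks (C := C) (D := 3 * (η / 4) * L) (by fun_prop)
      (fun x => by simpa [norm_expNeg] using hfC x) hL (fun b => ?_) a hS0.le).trans ?_
    · have := hK lam b L hL.le
      have hlam : ‖∫ x in 0..L, f x * expNeg lam x‖ < η / 4 * L := hlam
      linarith
    · rw [ge_iff_le, div_le_iff₀ hη] at hS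
      have : S / L * (3 * (η / 4) * L) = 3 * (η / 4) * S := by field_simp
      rw [this]
      linarith
  have hlarge : ∀ᶠ L : ℝ in atTop, 0 < L ∧ K ≤ η / 4 * L :=
    (eventually_gt_atTop 0).and
      ((tendsto_id.const_mul_atTop (by positivity : 0 < η / 4)).eventually_ge_atTop K)
  obtain ⟨L, hL, hKL⟩ := hlarge.exists
  have hcoc : {lam | ‖∫ x in 0..L, f x * expNeg lam x‖ < η / 4 * L} ∈ cocompact ℝ := by
    have := (tendsto_integral_expNeg_cocompact f hL.le).norm
    rw [norm_zero] at this
    exact this.eventually_lt_const (by positivity)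
  obtain ⟨k, hk, hkc⟩ := mem_cocompact.1 hcoc
  have hPk : P k := by
    refine hk.induction_on (p := P) ⟨1, one_pos, by simp⟩ hmono hunion fun lam _ => ?_
    have h1 := (hm lam).norm
    rw [norm_zero] at h1
    obtain ⟨L, hlt, hL, hKL⟩ :=
      ((h1.eventually_lt_const (by positivity : 0 < η / 4)).and hlarge).exists
    rw [norm_div, Complex.norm_real, Real.norm_of_nonneg hL.le, div_lt_iff₀ hL] at hlt
    exact ⟨_, mem_nhdsWithin_of_mem_nhds (((continuous_integral_expNeg hfc L).norm.tendsto
      lam).eventually_lt_const hlt), hprop hL hKL⟩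
  obtain ⟨S₀, hS₀, h⟩ := hmono (s := Set.univ) (fun lam _ => by
    by_cases h : lam ∈ k
    exacts [Or.inl h, Or.inr (hkc h)]) (hunion hPk (hprop hL hKL))
  exact ⟨S₀, hS₀, fun S hS lam a => h S hS lam trivial a⟩

/-- The autocorrelation of a square integrable function on the circle is the sum of its Fourier
series, whose coefficients are the squared moduli of those of the function. -/
lemma hasSum_autocorrelation {P : ℝ} [Fact (0 < P)] {F : AddCircle P → ℂ}
    (hF : MemLp F 2 AddCircle.haarAddCircle) (x : AddCircle P) :
    HasSum (fun k : ℤ => ((‖fourierCoeff F k‖ ^ 2 : ℝ) : ℂ) * fourier k x)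
      (∫ y, F (y + x) * starRingEnd ℂ (F y) ∂AddCircle.haarAddCircle) := by
  have hFx : MemLp (fun y => F (y + x)) 2 AddCircle.haarAddCircle :=
    hF.comp_measurePreserving (measurePreserving_add_right _ x)
  have hcoeff (k : ℤ) : fourierCoeff (fun y => F (y + x)) k = fourier k x * fourierCoeff F k := by
    simp only [fourierCoeff]
    rw [← integral_add_right_eq_self (fun t => fourier (-k) t • F t) x, ← integral_const_mul]
    refine integral_congr_ae (ae_of_all _ fun y => ?_)
    have h1 : fourier (-k) (y + x) = fourier (-k) y * fourier (-k) x := by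
      simp [fourier_apply, smul_add, AddCircle.toCircle_add]
    have h2 : fourier k x * fourier (-k) x = 1 := by
      rw [← fourier_add, add_neg_cancel, fourier_zero]
    simp only [smul_eq_mul, h1]
    linear_combination (-(fourier (-k) y * F (y + x))) * h2
  have h := fourierBasis.hasSum_inner_mul_inner hF.toLp hFx.toLp
  have hrepr (u : Lp ℂ 2 (AddCircle.haarAddCircle (T := P))) (k : ℤ) :
      inner ℂ (fourierBasis k) u = fourierCoeff u k := by
    rw [← fourierBasis.repr_apply_apply, fourierBasis_repr]
  have hterm (k : ℤ) : inner ℂ hF.toLp (fourierBasis k) * inner ℂ (fourierBasis k) hFx.toLp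
      = ((‖fourierCoeff F k‖ ^ 2 : ℝ) : ℂ) * fourier k x := by
    rw [← inner_conj_symm, hrepr, hrepr, fourierCoeff_congr_ae hF.coeFn_toLp,
      fourierCoeff_congr_ae hFx.coeFn_toLp, hcoeff, ← Complex.normSq_eq_norm_sq,
      ← Complex.mul_conj]
    ring
  simp only [hterm] at h
  convert! h using 1
  rw [MeasureTheory.L2.inner_def]
  refine integral_congr_ae ?_
  filter_upwards [hF.coeFn_toLp, hFx.coeFn_toLp] with y h1 h2
  rw [h1, h2, RCLike.inner_apply]

lemma conj_fourier_coe (P : ℝ) (k : ℤ) (x : ℝ) :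
    starRingEnd ℂ (fourier k (x : AddCircle P)) = expNeg (k / P) x := by
  rw [← fourier_neg, fourier_coe_apply, expNeg]
  congr 1
  push_cast
  ring

/-- A bounded continuous function on `[0, P]` has a continuous periodic autocorrelation, and
integrals against its conjugate are controlled by integrals against exponentials. -/
lemma exists_autocorrelation {f : ℝ → ℂ} (hfc : Continuous f) {C : ℝ} (hC : ∀ x, ‖f x‖ ≤ C)
    {P : ℝ} (hP : 0 < P) :
    ∃ G : ℝ → ℂ, Continuous G ∧ (∀ x, ‖G x‖ ≤ C ^ 2) ∧
      (∀ x ∈ Set.Icc 0 P,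
        ‖G x - (∫ t in 0..P, f (t + x) * starRingEnd ℂ (f t)) / P‖ ≤ 2 * C ^ 2 * x / P) ∧
      ∀ φ : ℝ → ℂ, Continuous φ → ∀ S B : ℝ,
        (∀ lam, ‖∫ x in 0..S, φ x * expNeg lam x‖ ≤ B) →
        ‖∫ x in 0..S, φ x * starRingEnd ℂ (G x)‖ ≤ C ^ 2 * B := by
  have : Fact (0 < P) := ⟨hP⟩
  have hC0 : 0 ≤ C := (norm_nonneg _).trans (hC 0)
  set F : AddCircle P → ℂ := AddCircle.liftIoc P 0 f with hF
  have hFC (y : AddCircle P) : ‖F y‖ ≤ C := hC _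
  have hFm : Measurable F :=
    hfc.measurable.comp (measurable_subtype_coe.comp (AddCircle.measurableEquivIoc P 0).measurable)
  have hFL : MemLp F 2 AddCircle.haarAddCircle :=
    MemLp.of_bound hFm.aestronglyMeasurable C (ae_of_all _ hFC)
  have hFf {t : ℝ} (h0 : 0 < t) (h1 : t ≤ P) : F t = f t :=
    AddCircle.liftIoc_zero_coe_apply ⟨h0, h1⟩
  have hbound (y z : AddCircle P) : ‖F y * starRingEnd ℂ (F z)‖ ≤ C ^ 2 := by
    rw [norm_mul, RCLike.norm_conj, sq]
    exact mul_le_mul (hFC _) (hFC _) (norm_nonneg _) hC0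
  set G : ℝ → ℂ := fun x => ∫ y, F (y + (x : AddCircle P)) * starRingEnd ℂ (F y)
    ∂AddCircle.haarAddCircle with hG
  have hGC (x : ℝ) : ‖G x‖ ≤ C ^ 2 := by
    simpa using norm_integral_le_of_norm_le_const (μ := AddCircle.haarAddCircle)
      (ae_of_all _ fun y : AddCircle P => hbound (y + x) y)
  set c : ℤ → ℝ := fun k => ‖fourierCoeff F k‖ ^ 2 with hc
  have hsum (x : ℝ) : HasSum (fun k : ℤ => (c k : ℂ) * fourier k (x : AddCircle P)) (G x) :=
    hasSum_autocorrelation hFL x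
  have hnorm (k : ℤ) (x : ℝ) : ‖(c k : ℂ) * fourier k (x : AddCircle P)‖ = c k := by
    rw [fourier_apply, norm_mul, Circle.norm_coe, mul_one, Complex.norm_real,
      Real.norm_of_nonneg (sq_nonneg _)]
  have hcs : Summable c := by
    simpa only [hnorm] using (hsum 0).summable.norm
  have hcle : ∑' k, c k ≤ C ^ 2 := by
    have h0 : (((∑' k, c k : ℝ)) : ℂ) = G 0 := by
      rw [Complex.ofReal_tsum]
      simpa using (hsum 0).tsum_eq
    have := hGC 0
    rw [← h0, Complex.norm_real] at this
    exact (le_abs_self _).trans this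
  have hcontf (k : ℤ) : Continuous fun x : ℝ => fourier k (x : AddCircle P) :=
    (map_continuous (fourier k)).comp (AddCircle.continuous_mk' P)
  have hGcont : Continuous G := by
    have : G = fun x : ℝ => ∑' k : ℤ, (c k : ℂ) * fourier k (x : AddCircle P) :=
      funext fun x => (hsum x).tsum_eq.symm
    rw [this]
    exact continuous_tsum (fun k => continuous_const.mul (hcontf k)) hcs
      fun k x => (hnorm k x).le
  refine ⟨G, hGcont, hGC, fun x hx => ?_, fun φ hφ S B hB => ?_⟩
  · set D : ℝ → ℂ := fun t => F (t + x : ℝ) * starRingEnd ℂ (F t)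
      - f (t + x) * starRingEnd ℂ (f t) with hD
    have hi1 (a b : ℝ) : IntervalIntegrable
        (fun t : ℝ => F (t + x : ℝ) * starRingEnd ℂ (F t)) volume a b := by
      refine (intervalIntegrable_const (c := C ^ 2)).mono_fun ?_
        (ae_of_all _ fun t => (hbound _ _).trans (le_abs_self _))
      have : Measurable fun t : ℝ => F (t + x : ℝ) * starRingEnd ℂ (F t) := by
        have := AddCircle.measurable_mk' (a := P)
        have := Complex.continuous_conj.measurable
        fun_prop
      exact this.aestronglyMeasurable
    have hi2 (a b : ℝ) : IntervalIntegrable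
        (fun t : ℝ => f (t + x) * starRingEnd ℂ (f t)) volume a b := by
      have := Complex.continuous_conj
      exact Continuous.intervalIntegrable (by fun_prop) a b
    have hiD (a b : ℝ) : IntervalIntegrable D volume a b := (hi1 a b).sub (hi2 a b)
    have e1 : G x = (∫ t in 0..P, F (t + x : ℝ) * starRingEnd ℂ (F t)) / P := by
      simp only [hG]
      rw [AddCircle.integral_haarAddCircle, ← AddCircle.intervalIntegral_preimage P 0, zero_add,
        Complex.real_smul, div_eq_inv_mul, Complex.ofReal_inv]
      rfl
    have e2 : ∫ t in 0..(P - x), D t = 0 := by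
      rw [intervalIntegral.integral_of_le (by linarith [hx.2])]
      refine setIntegral_eq_zero_of_forall_eq_zero fun t ht => ?_
      rw [hD]
      simp only
      rw [hFf (by linarith [ht.1, hx.1]) (by linarith [ht.2]),
        hFf ht.1 (by linarith [ht.2, hx.1]), sub_self]
    have e3 : ‖∫ t in (P - x)..P, D t‖ ≤ 2 * C ^ 2 * x := by
      have := intervalIntegral.norm_integral_le_of_norm_le_const (a := P - x) (b := P) (f := D)
        (C := 2 * C ^ 2) fun t _ => ?_
      · rwa [sub_sub_cancel, abs_of_nonneg hx.1] at this
      · refine (norm_sub_le _ _).trans ?_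
        have h1 := hbound (t + x : ℝ) t
        have h2 : ‖f (t + x) * starRingEnd ℂ (f t)‖ ≤ C ^ 2 := by
          rw [norm_mul, RCLike.norm_conj, sq]
          exact mul_le_mul (hC _) (hC _) (norm_nonneg _) hC0
        linarith
    rw [e1, ← sub_div, ← intervalIntegral.integral_sub (hi1 _ _) (hi2 _ _), norm_div,
      Complex.norm_real, Real.norm_of_nonneg hP.le,
      ← intervalIntegral.integral_add_adjacent_intervals (hiD 0 (P - x)) (hiD _ _), e2, zero_add]
    gcongr
  · have hs : HasSum (fun k : ℤ => ∫ x in 0..S, φ x * starRingEnd ℂ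
        ((c k : ℂ) * fourier k (x : AddCircle P))) (∫ x in 0..S, φ x * starRingEnd ℂ (G x)) := by
      have hconj := Complex.continuous_conj
      refine intervalIntegral.hasSum_integral_of_dominated_convergence
        (fun k x => ‖φ x‖ * c k) (fun k => ?_) (fun k => ae_of_all _ fun x _ => ?_)
        (ae_of_all _ fun x _ => hcs.mul_left _) ?_ (ae_of_all _ fun x _ => ?_)
      · have := hcontf k
        exact Continuous.aestronglyMeasurable (by fun_prop)
      · rw [norm_mul, RCLike.norm_conj, hnorm]
      · simp only [tsum_mul_left]
        exact Continuous.intervalIntegrable (by fun_prop) _ _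
      · exact ((hsum x).map (starRingEnd ℂ) hconj).mul_left _
    refine (hs.norm_le_of_bounded (hcs.hasSum.mul_right B) fun k => ?_).trans ?_
    · have : ∫ x in 0..S, φ x * starRingEnd ℂ ((c k : ℂ) * fourier k (x : AddCircle P))
          = c k * ∫ x in 0..S, φ x * expNeg (k / P) x := by
        rw [← intervalIntegral.integral_const_mul]
        refine intervalIntegral.integral_congr fun x _ => ?_
        simp only [map_mul, Complex.conj_ofReal, conj_fourier_coe]
        ring
      rw [this, norm_mul, Complex.norm_real, Real.norm_of_nonneg (sq_nonneg _)]
      exact mul_le_mul_of_nonneg_left (hB _) (sq_nonneg _)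
    · exact mul_le_mul_of_nonneg_right hcle ((norm_nonneg _).trans (hB 0))

lemma HasMean.norm_sub_le {f g : ℝ → ℂ} {a b : ℂ} {ε : ℝ} (hfc : Continuous f)
    (hgc : Continuous g) (hf : HasMean f a) (hg : HasMean g b) (h : ∀ x, ‖f x - g x‖ ≤ ε) :
    ‖a - b‖ ≤ ε := by
  refine le_of_tendsto (hf.sub hg).norm ?_
  filter_upwards [eventually_gt_atTop 0] with S hS
  rw [← sub_div, ← intervalIntegral.integral_sub (hfc.intervalIntegrable _ _)
    (hgc.intervalIntegrable _ _), norm_div, Complex.norm_real, Real.norm_of_nonneg hS.le,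
    div_le_iff₀ hS]
  simpa [abs_of_pos hS] using
    intervalIntegral.norm_integral_le_of_norm_le_const (a := 0) (b := S) fun x _ => h x

/-- The mean autocorrelation of an almost periodic function is almost periodic. -/
lemma APR.of_autocorrelation {f g : ℝ → ℂ} (hf : APR f)
    (hg : ∀ x, HasMean (fun t => f (t + x) * starRingEnd ℂ (f t)) (g x)) : APR g := by
  obtain ⟨C, hC, hfC⟩ := hf.exists_bound
  have hfc := hf.1
  have hconj := Complex.continuous_conj
  have key {x y ε : ℝ} (h : ∀ t, ‖f (t + x) - f (t + y)‖ ≤ ε / C) : ‖g x - g y‖ ≤ ε := by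
    refine (hg x).norm_sub_le (by fun_prop) (by fun_prop) (hg y) fun t => ?_
    rw [← sub_mul, norm_mul, RCLike.norm_conj]
    refine (mul_le_mul (h t) (hfC t) (norm_nonneg _) ((norm_nonneg _).trans (h t))).trans_eq ?_
    field_simp
  refine ⟨Metric.continuous_iff.2 fun y ε hε => ?_, fun ε hε => ?_⟩
  · obtain ⟨δ, hδ, hd⟩ := hf.exists_delta (ε := ε / 2 / C) (by positivity)
    refine ⟨δ, hδ, fun x hx => ?_⟩
    rw [dist_eq_norm]
    refine (key fun t => hd _ _ ?_).trans_lt (half_lt_self hε)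
    rw [add_sub_add_left_eq_sub]
    exact hx.le
  · obtain ⟨l, hl, h⟩ := hf.2 (ε / C) (by positivity)
    refine ⟨l, hl, fun x => ?_⟩
    obtain ⟨τ, hτ, hxτ⟩ := h x
    refine ⟨τ, fun y => key fun t => ?_, hxτ⟩
    simpa only [add_assoc] using hτ (t + y)

/-- Integrals against the mean autocorrelation are controlled by integrals against
exponentials. -/
lemma norm_integral_mul_conj_autocorrelation_le {f g : ℝ → ℂ} (hfc : Continuous f) {C : ℝ}
    (hC : ∀ x, ‖f x‖ ≤ C) (hg : ∀ x, HasMean (fun t => f (t + x) * starRingEnd ℂ (f t)) (g x))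
    {φ : ℝ → ℂ} (hφ : Continuous φ) {S B : ℝ} (hS : 0 ≤ S)
    (hB : ∀ lam, ‖∫ x in 0..S, φ x * expNeg lam x‖ ≤ B) :
    ‖∫ x in 0..S, φ x * starRingEnd ℂ (g x)‖ ≤ C ^ 2 * B := by
  have hconj := Complex.continuous_conj
  choose G hGc hGC hGa hGi using fun n : ℕ => exists_autocorrelation hfc hC n.cast_add_one_pos
  have hP : Tendsto (fun n : ℕ => (n : ℝ) + 1) atTop atTop :=
    tendsto_natCast_atTop_atTop.atTop_add tendsto_const_nhds
  have hlim {x : ℝ} (hx : 0 ≤ x) : Tendsto (fun n => G n x) atTop (𝓝 (g x)) := by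
    have h1 : Tendsto (fun n : ℕ => G n x - (∫ t in 0..((n : ℝ) + 1),
        f (t + x) * starRingEnd ℂ (f t)) / ((n + 1 : ℝ) : ℂ)) atTop (𝓝 0) := by
      refine squeeze_zero_norm' (a := fun n : ℕ => 2 * C ^ 2 * x / ((n : ℝ) + 1)) ?_
        (tendsto_const_nhds.div_atTop hP)
      filter_upwards [hP.eventually_ge_atTop x] with n hn
      exact hGa n x ⟨hx, hn⟩
    simpa [Function.comp_def] using h1.add ((hg x).comp hP)
  refine le_of_tendsto (Tendsto.norm
    (intervalIntegral.tendsto_integral_filter_of_dominated_convergence (l := atTop)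
      (F := fun n x => φ x * starRingEnd ℂ (G n x)) (fun x => ‖φ x‖ * C ^ 2)
    (.of_forall fun n => ?_) (.of_forall fun n => ae_of_all _ fun x _ => ?_) ?_
    (ae_of_all _ fun x hx => ?_))) (.of_forall fun n => hGi n φ hφ S B hB)
  · have := hGc n
    exact Continuous.aestronglyMeasurable (by fun_prop)
  · rw [norm_mul, RCLike.norm_conj]
    gcongr
    exact hGC n x
  · exact Continuous.intervalIntegrable (by fun_prop) _ _
  · rw [Set.uIoc_of_le hS] at hx
    exact ((hconj.tendsto _).comp (hlim hx.1.le)).const_mul _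

/-- An almost periodic function all of whose Fourier coefficients vanish is zero. -/
lemma APR.eq_zero_of_forall_hasMean {f : ℝ → ℂ} (hf : APR f)
    (hm : ∀ lam, HasMean (fun x => f x * expNeg lam x) 0) (x₀ : ℝ) : f x₀ = 0 := by
  obtain ⟨C, hC, hfC⟩ := hf.exists_bound
  have hfc := hf.1
  have hconj := Complex.continuous_conj
  choose g hgu using fun x => ((hf.comp_add_right x).mul hf.conj).exists_unifMean
  have hg (x : ℝ) : HasMean (fun t => f (t + x) * starRingEnd ℂ (f t)) (g x) := (hgu x).hasMean
  have hgAP := hf.of_autocorrelation hg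
  have hgc := hgAP.1
  have hgg {η : ℝ} (hη : 0 < η) : ∃ S₀ > 0, ∀ S ≥ S₀,
      ‖∫ x in 0..S, g x * starRingEnd ℂ (g x)‖ ≤ C ^ 3 * η * S := by
    obtain ⟨S₀, hS₀, h⟩ := hf.uniform_small hm hη
    refine ⟨S₀, hS₀, fun S hS => ?_⟩
    have hS0 : 0 < S := hS₀.trans_le hS
    have hinner (t : ℝ) : ‖∫ x in 0..S, f (t + x) * starRingEnd ℂ (g x)‖ ≤ C ^ 2 * (η * S) := by
      refine norm_integral_mul_conj_autocorrelation_le hfc hfC hg (by fun_prop) hS0.le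
        fun lam => ?_
      have := h S hS lam t
      have e : ∫ x in t..(t + S), f x * expNeg lam x
          = expNeg lam t * ∫ x in 0..S, f (t + x) * expNeg lam x := by
        have := intervalIntegral.integral_comp_add_left (a := 0) (b := S)
          (fun x => f x * expNeg lam x) t
        rw [add_zero] at this
        rw [← this, ← intervalIntegral.integral_const_mul]
        refine intervalIntegral.integral_congr fun x _ => ?_
        simp only [expNeg_add_right]
        ring
      rwa [e, norm_mul, norm_expNeg, one_mul] at this
    have hsq (t x : ℝ) : ‖f (t + x) * starRingEnd ℂ (f t)‖ ≤ C ^ 2 := by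
      rw [norm_mul, RCLike.norm_conj, sq]
      exact mul_le_mul (hfC _) (hfC _) (norm_nonneg _) hC.le
    refine le_of_tendsto (Tendsto.norm
      (intervalIntegral.tendsto_integral_filter_of_dominated_convergence (l := atTop)
        (F := fun (P : ℝ) x => (∫ t in 0..P, f (t + x) * starRingEnd ℂ (f t)) / P
          * starRingEnd ℂ (g x)) (fun x => C ^ 2 * ‖g x‖)
        ?_ ?_ ?_ (ae_of_all _ fun x _ => (hg x).mul_const _))) ?_
    · refine .of_forall fun P => Continuous.aestronglyMeasurable ?_
      have : Continuous fun x => ∫ t in 0..P, f (t + x) * starRingEnd ℂ (f t) :=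
        intervalIntegral.continuous_parametric_intervalIntegral_of_continuous' (by fun_prop) _ _
      fun_prop
    · filter_upwards [eventually_gt_atTop 0] with P hP
      refine ae_of_all _ fun x _ => ?_
      rw [norm_mul, RCLike.norm_conj, norm_div, Complex.norm_real, Real.norm_of_nonneg hP.le]
      gcongr
      rw [div_le_iff₀ hP]
      simpa [abs_of_pos hP] using intervalIntegral.norm_integral_le_of_norm_le_const
        (a := 0) (b := P) fun t _ => hsq t x
    · exact Continuous.intervalIntegrable (by fun_prop) _ _
    · filter_upwards [eventually_gt_atTop 0] with P hP
      have e : ∫ x in 0..S, (∫ t in 0..P, f (t + x) * starRingEnd ℂ (f t)) / P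
          * starRingEnd ℂ (g x) = (∫ t in 0..P, starRingEnd ℂ (f t) *
            ∫ x in 0..S, f (t + x) * starRingEnd ℂ (g x)) / P := by
        simp only [div_mul_eq_mul_div, intervalIntegral.integral_div,
          ← intervalIntegral.integral_mul_const, ← intervalIntegral.integral_const_mul]
        rw [intervalIntegral_intervalIntegral_swap]
        · congr 1
          refine intervalIntegral.integral_congr fun t _ =>
            intervalIntegral.integral_congr fun x _ => ?_
          ring
        · refine (Continuous.continuousOn ?_).integrableOn_compact
            (isCompact_uIcc.prod isCompact_uIcc) |>.mono_set
            (Set.prod_mono Set.uIoc_subset_uIcc Set.uIoc_subset_uIcc)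
          fun_prop
      rw [e, norm_div, Complex.norm_real, Real.norm_of_nonneg hP.le, div_le_iff₀ hP]
      refine (intervalIntegral.norm_integral_le_of_norm_le_const (a := 0) (b := P)
        (C := C ^ 3 * η * S) fun t _ => ?_).trans_eq (by rw [sub_zero, abs_of_pos hP])
      rw [norm_mul, RCLike.norm_conj]
      refine (mul_le_mul (hfC t) (hinner t) (norm_nonneg _) hC.le).trans_eq ?_
      ring
  have hgzero : HasMean (fun x => g x * starRingEnd ℂ (g x)) 0 := by
    refine Metric.tendsto_atTop.2 fun ε hε => ?_
    obtain ⟨S₀, hS₀, h⟩ := hgg (η := ε / 2 / C ^ 3) (by positivity)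
    refine ⟨S₀, fun S hS => ?_⟩
    have hS0 : 0 < S := hS₀.trans_le hS
    have := h S hS
    rw [mul_div_cancel₀ _ (by positivity)] at this
    rw [dist_zero_right, norm_div, Complex.norm_real, Real.norm_of_nonneg hS0.le, div_lt_iff₀ hS0]
    refine this.trans_lt ?_
    gcongr
    exact half_lt_self hε
  refine hf.eq_zero_of_hasMean ?_ x₀
  have := hg 0
  rw [hgAP.eq_zero_of_hasMean hgzero 0] at this
  simpa only [add_zero] using this

/-- Lemma 4.3 (1)-(3): existence of means, countability of the spectrum, and uniqueness. -/
theorem stmt12 (f : ℝ → ℂ) (hf : APR f) :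
    ∃ m : ℝ → ℂ, (∀ lam : ℝ, HasMeanR f lam (m lam)) ∧
      {lam : ℝ | m lam ≠ 0}.Countable ∧
      ((∀ lam : ℝ, m lam = 0) → ∀ x : ℝ, f x = 0) := by
  obtain ⟨C, hC, hfC⟩ := hf.exists_bound
  choose m hm using fun lam => (hf.mul (APR_expNeg lam)).exists_unifMean
  refine ⟨m, fun lam => (hm lam).hasMeanR,
    countable_of_hasMean hf.1 hfC fun lam => (hm lam).hasMean, fun h0 => ?_⟩
  exact hf.eq_zero_of_forall_hasMean fun lam => h0 lam ▸ (hm lam).hasMean
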